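/- Let n ≥ 2, r₁, r₂ > 0, and b₁, b₂ ∈ ℝⁿ. Then the Euclidean closed balls closedBall(b₁, r₁) and closedBall(b₂, r₂) are causally disjoint if and only if ‖b⃗₁ − b⃗₂‖ − |b₁₀ − b₂₀| > √2 (r₁ + r₂). -/

import Mathlib

open Set Metric unitInterval

noncomputable section

/-- `n`-dimensional Minkowski space, modeled as `ℝⁿ` with the Euclidean norm. -/
abbrev Mink (n : ℕ) := EuclideanSpace ℝ (Fin n)

/-- The spatial part `x⃗ = (x 1, …, x (n-1)) ∈ ℝ^{n-1}` of `x ∈ ℝⁿ`. -/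
def spatial {n : ℕ} (x : Mink n) : Mink (n - 1) :=
  (WithLp.equiv 2 _).symm fun i : Fin (n - 1) => x ⟨i.1 + 1, by have := i.isLt; omega⟩

/-- A curve `γ` is future-directed causal if it is `C¹` and
`(γ₀)'(t) ≥ ‖(γ⃗)'(t)‖` for all `t ∈ [0,1]`. -/
def FDCausal {n : ℕ} [NeZero n] (γ : ℝ → Mink n) : Prop :=
  ContDiff ℝ 1 γ ∧
    ∀ t ∈ Set.Icc (0 : ℝ) 1,
      ‖deriv (fun s => spatial (γ s)) t‖ ≤ deriv (fun s => γ s 0) t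

/-- A curve `γ` is past-directed causal if it is `C¹` and
`-(γ₀)'(t) ≥ ‖(γ⃗)'(t)‖` for all `t ∈ [0,1]`. -/
def PDCausal {n : ℕ} [NeZero n] (γ : ℝ → Mink n) : Prop :=
  ContDiff ℝ 1 γ ∧
    ∀ t ∈ Set.Icc (0 : ℝ) 1,
      ‖deriv (fun s => spatial (γ s)) t‖ ≤ -(deriv (fun s => γ s 0) t)

/-- A causal curve is a future- or past-directed causal curve. -/
def IsCausalCurve {n : ℕ} [NeZero n] (γ : ℝ → Mink n) : Prop :=
  FDCausal γ ∨ PDCausal γ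

/-- `S` and `T` are causally disjoint if no causal curve starts in `S` and ends in `T`. -/
def CausallyDisjoint {n : ℕ} [NeZero n] (S T : Set (Mink n)) : Prop :=
  ¬ ∃ γ : ℝ → Mink n, IsCausalCurve γ ∧ γ 0 ∈ S ∧ γ 1 ∈ T

lemma norm_sq_eq_time_add_spatial {n : ℕ} [NeZero n] (x : Mink n) :
    ‖x‖ ^ 2 = x 0 ^ 2 + ‖spatial x‖ ^ 2 := by
  obtain _ | m := n
  · exact absurd rfl (NeZero.ne 0)
  · rw [EuclideanSpace.norm_sq_eq, EuclideanSpace.norm_sq_eq, Fin.sum_univ_succ]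
    simp only [Real.norm_eq_abs, sq_abs]
    rfl

lemma exists_time_spatial {n : ℕ} [NeZero n] (a : ℝ) (e : Mink (n - 1)) :
    ∃ x : Mink n, x 0 = a ∧ spatial x = e := by
  obtain _ | m := n
  · exact absurd rfl (NeZero.ne 0)
  · exact ⟨WithLp.toLp 2 (Fin.cons a fun i => e i), rfl, rfl⟩

/-- The spatial part as a continuous linear map. -/
def spatialCLM (n : ℕ) : Mink n →L[ℝ] Mink (n - 1) :=
  LinearMap.toContinuousLinearMap
    { toFun := spatial
      map_add' := fun _ _ => rfl
      map_smul' := fun _ _ => rfl }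

lemma abs_time_add_norm_spatial_le {n : ℕ} [NeZero n] {x : Mink n} {r : ℝ} (hx : ‖x‖ ≤ r) :
    |x 0| + ‖spatial x‖ ≤ √2 * r := by
  have h := norm_sq_eq_time_add_spatial x
  have h0 : 0 ≤ r := (norm_nonneg x).trans hx
  have h2 : ‖x‖ ^ 2 ≤ r ^ 2 := by gcongr
  apply le_of_pow_le_pow_left₀ two_ne_zero (by positivity)
  rw [mul_pow, Real.sq_sqrt zero_le_two]
  nlinarith [sq_abs (x 0), sq_nonneg (|x 0| - ‖spatial x‖)]

/-- If the velocity of a `C¹` curve satisfies `‖(γ⃗)'‖ ≤ κ (γ₀)'`, then so does its total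
displacement. -/
lemma norm_spatial_sub_le {n : ℕ} [NeZero n] {γ : ℝ → Mink n} (κ : ℝ) (hγ : ContDiff ℝ 1 γ)
    (h : ∀ t ∈ Set.Icc (0 : ℝ) 1,
      ‖deriv (fun s => spatial (γ s)) t‖ ≤ κ * deriv (fun s => γ s 0) t) :
    ‖spatial (γ 1) - spatial (γ 0)‖ ≤ κ * (γ 1 0 - γ 0 0) := by
  have hd : Differentiable ℝ γ := hγ.differentiable one_ne_zero
  have hs : Differentiable ℝ fun s => spatial (γ s) := (spatialCLM n).differentiable.comp hd
  have ht : Differentiable ℝ fun s => γ s 0 :=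
    (EuclideanSpace.proj (0 : Fin n) : Mink n →L[ℝ] ℝ).differentiable.comp hd
  exact image_norm_le_of_norm_deriv_right_le_deriv_boundary
    (f := fun s => spatial (γ s) - spatial (γ 0)) (B := fun s => κ * (γ s 0 - γ 0 0))
    (hs.continuous.sub continuous_const).continuousOn
    (fun t _ => ((hs t).hasDerivAt.sub_const _).hasDerivWithinAt)
    (by simp) (fun t => ((ht t).hasDerivAt.sub_const _).const_mul κ)
    (fun t ht => h t (Ico_subset_Icc_self ht)) (right_mem_Icc.2 zero_le_one)

lemma IsCausalCurve.norm_spatial_sub_le {n : ℕ} [NeZero n] {γ : ℝ → Mink n}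
    (hγ : IsCausalCurve γ) : ‖spatial (γ 1) - spatial (γ 0)‖ ≤ |γ 1 0 - γ 0 0| := by
  rcases hγ with ⟨hγ, h⟩ | ⟨hγ, h⟩
  · refine (_root_.norm_spatial_sub_le 1 hγ (by simpa using h)).trans ?_
    rw [one_mul]
    exact le_abs_self _
  · refine (_root_.norm_spatial_sub_le (-1) hγ (by simpa using h)).trans ?_
    rw [neg_one_mul]
    exact neg_le_abs _

lemma isCausalCurve_segment {n : ℕ} [NeZero n] {p v : Mink n} (h : ‖spatial v‖ ≤ |v 0|) :
    IsCausalCurve fun t : ℝ => p + t • v := by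
  have hc : ContDiff ℝ 1 fun t : ℝ => p + t • v := by fun_prop
  have hs : ∀ t, deriv (fun s : ℝ => spatial (p + s • v)) t = spatial v := fun t => by
    have := ((hasDerivAt_id t).smul_const (spatial v)).const_add (spatial p)
    rw [one_smul] at this
    exact this.deriv
  have ht : ∀ t, deriv (fun s : ℝ => (p + s • v) 0) t = v 0 := fun t => by
    have := ((hasDerivAt_id t).mul_const (v 0)).const_add (p 0)
    rw [one_mul] at this
    exact this.deriv
  rcases le_total 0 (v 0) with h0 | h0
  · exact .inl ⟨hc, fun t _ => by rwa [hs, ht, ← abs_of_nonneg h0]⟩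
  · exact .inr ⟨hc, fun t _ => by rwa [hs, ht, ← abs_of_nonpos h0]⟩

/-- Causal disjointness in terms of pairs of points. -/
lemma causallyDisjoint_iff {n : ℕ} [NeZero n] {S T : Set (Mink n)} :
    CausallyDisjoint S T ↔
      ∀ p ∈ S, ∀ q ∈ T, |q 0 - p 0| < ‖spatial q - spatial p‖ := by
  refine ⟨fun h p hp q hq => ?_, ?_⟩
  · by_contra! hpq
    exact h ⟨fun t => p + t • (q - p), isCausalCurve_segment hpq, by simpa, by simpa⟩
  · rintro h ⟨γ, hγ, h0, h1⟩
    exact (h _ h0 _ h1).not_ge hγ.norm_spatial_sub_le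

/-- Two Euclidean balls are causally disjoint iff
`‖b⃗₁ - b⃗₂‖ - |b₁₀ - b₂₀| > √2 (r₁ + r₂)`. -/
theorem causallyDisjoint_balls_iff (n : ℕ) [NeZero n] (hn : 2 ≤ n)
    (r₁ r₂ : ℝ) (hr₁ : 0 < r₁) (hr₂ : 0 < r₂) (b₁ b₂ : Mink n) :
    CausallyDisjoint (closedBall b₁ r₁) (closedBall b₂ r₂) ↔
      Real.sqrt 2 * (r₁ + r₂) < ‖spatial b₁ - spatial b₂‖ - |b₁ 0 - b₂ 0| := by
  rw [causallyDisjoint_iff]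
  constructor
  · intro h
    by_contra! hle
    set D := spatial b₁ - spatial b₂ with hD
    obtain ⟨κ, hκ, hκT⟩ : ∃ κ : ℝ, |κ| = 1 ∧ b₁ 0 - b₂ 0 = κ * |b₁ 0 - b₂ 0| := by
      rcases le_total 0 (b₁ 0 - b₂ 0) with h0 | h0
      · exact ⟨1, by simp, by rw [abs_of_nonneg h0, one_mul]⟩
      · exact ⟨-1, by simp, by rw [abs_of_nonpos h0]; ring⟩
    set e := ‖D‖⁻¹ • D with he
    have hDe : D = ‖D‖ • e := by
      rcases eq_or_ne D 0 with h0 | h0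
      · simp [h0]
      · rw [he, smul_inv_smul₀ (norm_ne_zero_iff.2 h0)]
    have he1 : ‖e‖ ≤ 1 := by
      rw [he, norm_smul, norm_inv, norm_norm]
      exact inv_mul_le_one
    obtain ⟨w, hw0, hws⟩ := exists_time_spatial (n := n) κ (-e)
    have hs2 : √2 ^ 2 = 2 := Real.sq_sqrt zero_le_two
    have hs0 : 0 < √2 := by positivity
    have hw : ‖w‖ ≤ √2 := by
      apply le_of_pow_le_pow_left₀ two_ne_zero hs0.le
      rw [norm_sq_eq_time_add_spatial, hw0, hws, hs2, ← sq_abs κ, hκ, norm_neg]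
      nlinarith [norm_nonneg e]
    have hball : ∀ r : ℝ, 0 < r → ‖(r / √2) • w‖ ≤ r := fun r hr => by
      rw [norm_smul, Real.norm_of_nonneg (by positivity), div_mul_eq_mul_div, div_le_iff₀ hs0]
      gcongr
    have := h (b₁ + (r₁ / √2) • w) (by simpa using hball r₁ hr₁)
      (b₂ - (r₂ / √2) • w) (by simpa [norm_neg, sub_eq_add_neg] using hball r₂ hr₂)
    set c := (r₁ + r₂) / √2 with hc
    have hc0 : 0 < c := by positivity
    have h2c : √2 * (r₁ + r₂) = 2 * c := by
      rw [hc]; field_simp; rw [hs2]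
    have hspatial : spatial (b₂ - (r₂ / √2) • w) - spatial (b₁ + (r₁ / √2) • w)
        = (c - ‖D‖) • e := by
      have : spatial (b₂ - (r₂ / √2) • w) - spatial (b₁ + (r₁ / √2) • w)
          = (spatial b₂ - (r₂ / √2) • spatial w) - (spatial b₁ + (r₁ / √2) • spatial w) := rfl
      rw [this, hws, sub_smul, ← hDe, hD, hc]
      module
    have htime : (b₂ - (r₂ / √2) • w) 0 - (b₁ + (r₁ / √2) • w) 0
        = -(κ * (|b₁ 0 - b₂ 0| + c)) := by
      simp only [PiLp.sub_apply, PiLp.add_apply, PiLp.smul_apply, smul_eq_mul, hw0, mul_add,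
        ← hκT, hc]
      ring
    rw [hspatial, htime, abs_neg, abs_mul, hκ, one_mul, abs_of_nonneg (by positivity),
      norm_smul, Real.norm_eq_abs] at this
    have h1 : |c - ‖D‖| * ‖e‖ ≤ |c - ‖D‖| := mul_le_of_le_one_right (abs_nonneg _) he1
    have h2 : |c - ‖D‖| ≤ |b₁ 0 - b₂ 0| + c := by
      rw [abs_le]
      constructor <;> linarith [norm_nonneg D, abs_nonneg (b₁ 0 - b₂ 0)]
    linarith
  · intro h p hp q hq
    have hu := abs_time_add_norm_spatial_le (mem_closedBall_iff_norm.1 hp)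
    have hv := abs_time_add_norm_spatial_le (mem_closedBall_iff_norm.1 hq)
    have ht : |q 0 - p 0| ≤ |(p - b₁) 0| + |(q - b₂) 0| + |b₁ 0 - b₂ 0| := by
      have : q 0 - p 0 = -(p - b₁) 0 + (q - b₂) 0 + -(b₁ 0 - b₂ 0) := by
        simp only [PiLp.sub_apply]; ring
      rw [this]
      simpa only [abs_neg] using abs_add_three (-(p - b₁) 0) ((q - b₂) 0) (-(b₁ 0 - b₂ 0))
    have hs : ‖spatial b₁ - spatial b₂‖
        ≤ ‖spatial (p - b₁)‖ + ‖spatial (q - b₂)‖ + ‖spatial q - spatial p‖ := by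
      have : spatial b₁ - spatial b₂
          = -spatial (p - b₁) + spatial (q - b₂) + -(spatial q - spatial p) := by
        have h1 : spatial (p - b₁) = spatial p - spatial b₁ := rfl
        have h2 : spatial (q - b₂) = spatial q - spatial b₂ := rfl
        rw [h1, h2]; abel
      rw [this]
      simpa only [norm_neg] using
        norm_add₃_le (a := -spatial (p - b₁)) (b := spatial (q - b₂))
          (c := -(spatial q - spatial p))
    linarith
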